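/- arXiv:1508.01839 — 2 statements merged into one kernel-verified Lean document; each statement's English description precedes it below -/
import Mathlib

section
/- Let S be a q-Steiner system S_q(2,3,7) containing both blocks Z₁ = {x ∈ 𝔽^7 : x₁ = x₂ = x₃ = x₄ = 0} and Z₂ = {x ∈ 𝔽^7 : x₄ = x₅ = x₆ = x₇ = 0}. Then the number of blocks B ∈ S whose intersection with Z₁ is nontrivial and whose intersection with Z₂ is also nontrivial (i.e., B ∩ Z₁ ≠ {0} and B ∩ Z₂ ≠ {0}) is exactly (q² + q + 1)². -/
/-- A `q`-Steiner system `S_q(t,k,n)`: a set `S` of `k`-dimensional subspaces (blocks) of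
`F^n` such that every `t`-dimensional subspace of `F^n` is contained in exactly one block. -/
def IsSteinerSystem (F : Type) [Field F] (t k n : ℕ)
    (S : Set (Submodule F (Fin n → F))) : Prop :=
  (∀ B ∈ S, Module.finrank F B = k) ∧
  ∀ T : Submodule F (Fin n → F), Module.finrank F T = t → ∃! B, B ∈ S ∧ T ≤ B

/-- The subspace of vectors of `F^n` vanishing on a given set of coordinates. -/
def coordZero (F : Type) [Field F] {n : ℕ} (s : Set (Fin n)) :
    Submodule F (Fin n → F) where
  carrier := {x | ∀ i ∈ s, x i = 0}
  add_mem' := by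
    intro a b ha hb i hi
    simp [ha i hi, hb i hi]
  zero_mem' := by intro i _; rfl
  smul_mem' := by
    intro c x hx i hi
    simp [hx i hi]

section

variable {F : Type} [Field F] {n : ℕ}

/-- The one-dimensional subspaces contained in a finite-dimensional subspace `U` over a finite
field are as many as the points of the projective space of `U`. -/
theorem ncard_finrank_one_le [Finite F] {V : Type*} [AddCommGroup V] [Module F V]
    (U : Submodule F V) {d : ℕ} (hU : Module.finrank F U = d) :
    {L : Submodule F V | Module.finrank F L = 1 ∧ L ≤ U}.ncard =
      ∑ i ∈ Finset.range d, Nat.card F ^ i := by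
  have himage : {L : Submodule F V | Module.finrank F L = 1 ∧ L ≤ U} =
      Submodule.map U.subtype '' {H : Submodule F U | Module.finrank F H = 1} := by
    ext L
    constructor
    · rintro ⟨hL, hLU⟩
      have hmap : (L.comap U.subtype).map U.subtype = L := by
        rw [Submodule.map_comap_subtype, inf_eq_right.2 hLU]
      refine ⟨L.comap U.subtype, ?_, hmap⟩
      rw [Set.mem_ofPred_eq, ← Submodule.finrank_map_subtype_eq, hmap, hL]
    · rintro ⟨H, hH, rfl⟩
      exact ⟨(Submodule.finrank_map_subtype_eq U H).trans hH, Submodule.map_subtype_le U H⟩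
  rw [himage, Set.ncard_image_of_injective _
    (Submodule.map_injective_of_injective U.injective_subtype),
    ← Projectivization.card_of_finrank F U hU]
  exact (Nat.card_congr (Projectivization.equivSubmodule F U)).symm

theorem exists_finrank_eq_two_le {V : Type*} [AddCommGroup V] [Module F V]
    {U : Submodule F V} (hU : 2 ≤ Module.finrank F U) :
    ∃ T : Submodule F V, Module.finrank F T = 2 ∧ T ≤ U := by
  obtain ⟨v, hv⟩ := exists_linearIndependent_of_le_finrank hU
  refine ⟨(Submodule.span F (Set.range v)).map U.subtype, ?_, Submodule.map_subtype_le U _⟩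
  rw [Submodule.finrank_map_subtype_eq, finrank_span_eq_card hv, Fintype.card_fin]

theorem finrank_sup_eq_two_of_disjoint {V : Type*} [AddCommGroup V] [Module F V]
    {L M : Submodule F V} (hL : Module.finrank F L = 1) (hM : Module.finrank F M = 1)
    (h : Disjoint L M) : Module.finrank F ↥(L ⊔ M) = 2 := by
  have := Module.finite_of_finrank_eq_succ hL
  have := Module.finite_of_finrank_eq_succ hM
  have hsum := Submodule.finrank_sup_add_finrank_inf_eq L M
  rwa [h.eq_bot, finrank_bot, hL, hM] at hsum

namespace IsSteinerSystem

variable {k : ℕ} {S : Set (Submodule F (Fin n → F))}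

/-- Two distinct blocks with nontrivial intersection meet in a single point. -/
theorem finrank_inf_eq_one (hS : IsSteinerSystem F 2 k n S) {B U : Submodule F (Fin n → F)}
    (hB : B ∈ S) (hU : U ∈ S) (hne : B ≠ U) (hinf : B ⊓ U ≠ ⊥) :
    Module.finrank F ↥(B ⊓ U) = 1 := by
  have hpos : Module.finrank F ↥(B ⊓ U) ≠ 0 := fun h => hinf (Submodule.finrank_eq_zero.1 h)
  by_contra hone
  obtain ⟨T, hT, hTle⟩ := exists_finrank_eq_two_le (U := B ⊓ U) (by omega)
  exact hne ((hS.2 T hT).unique ⟨hB, hTle.trans inf_le_left⟩ ⟨hU, hTle.trans inf_le_right⟩)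

/-- Blocks meeting two disjoint blocks `U` and `W` correspond to pairs consisting of a point of
`U` and a point of `W`. -/
theorem bijOn_inf (hS : IsSteinerSystem F 2 k n S) {U W : Submodule F (Fin n → F)}
    (hU : U ∈ S) (hW : W ∈ S) (hUW : Disjoint U W) :
    Set.BijOn (fun B => (B ⊓ U, B ⊓ W)) {B ∈ S | B ⊓ U ≠ ⊥ ∧ B ⊓ W ≠ ⊥}
      ({L : Submodule F (Fin n → F) | Module.finrank F L = 1 ∧ L ≤ U} ×ˢ
        {M : Submodule F (Fin n → F) | Module.finrank F M = 1 ∧ M ≤ W}) := by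
  have hmaps : ∀ B ∈ S, B ⊓ U ≠ ⊥ → B ⊓ W ≠ ⊥ →
      Module.finrank F ↥(B ⊓ U) = 1 ∧ Module.finrank F ↥(B ⊓ W) = 1 := by
    intro B hB hBU hBW
    refine ⟨hS.finrank_inf_eq_one hB hU ?_ hBU, hS.finrank_inf_eq_one hB hW ?_ hBW⟩
    · rintro rfl
      exact hBW hUW.eq_bot
    · rintro rfl
      exact hBU hUW.symm.eq_bot
  refine ⟨?_, ?_, ?_⟩
  · rintro B ⟨hB, hBU, hBW⟩
    exact ⟨⟨(hmaps B hB hBU hBW).1, inf_le_right⟩, ⟨(hmaps B hB hBU hBW).2, inf_le_right⟩⟩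
  · rintro B ⟨hB, hBU, hBW⟩ C ⟨hC, -, -⟩ heq
    obtain ⟨hCU, hCW⟩ := Prod.ext_iff.1 heq
    have htwo := finrank_sup_eq_two_of_disjoint (hmaps B hB hBU hBW).1 (hmaps B hB hBU hBW).2
      (hUW.mono inf_le_right inf_le_right)
    refine (hS.2 _ htwo).unique ⟨hB, sup_le inf_le_left inf_le_left⟩ ⟨hC, sup_le ?_ ?_⟩
    · exact hCU.le.trans inf_le_left
    · exact hCW.le.trans inf_le_left
  · rintro ⟨L, M⟩ ⟨⟨hL, hLU⟩, ⟨hM, hMW⟩⟩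
    obtain ⟨B, ⟨hB, hLMB⟩, -⟩ :=
      hS.2 _ (finrank_sup_eq_two_of_disjoint hL hM (hUW.mono hLU hMW))
    have hLB : L ≤ B ⊓ U := le_inf (le_sup_left.trans hLMB) hLU
    have hMB : M ≤ B ⊓ W := le_inf (le_sup_right.trans hLMB) hMW
    have hBU : B ⊓ U ≠ ⊥ := by
      intro h
      rw [le_bot_iff.1 (hLB.trans h.le), finrank_bot] at hL
      exact zero_ne_one hL
    have hBW : B ⊓ W ≠ ⊥ := by
      intro h
      rw [le_bot_iff.1 (hMB.trans h.le), finrank_bot] at hM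
      exact zero_ne_one hM
    obtain ⟨hLd, hMd⟩ := hmaps B hB hBU hBW
    exact ⟨B, ⟨hB, hBU, hBW⟩, Prod.ext
      (Submodule.eq_of_le_of_finrank_eq hLB (hL.trans hLd.symm)).symm
      (Submodule.eq_of_le_of_finrank_eq hMB (hM.trans hMd.symm)).symm⟩

end IsSteinerSystem

theorem disjoint_coordZero {s t : Set (Fin n)} (h : s ∪ t = Set.univ) :
    Disjoint (coordZero F s) (coordZero F t) := by
  rw [Submodule.disjoint_def]
  intro x hs ht
  funext i
  exact (h.symm ▸ Set.mem_univ i : i ∈ s ∪ t).elim (hs i) (ht i)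

end

/-- In a `q`-Steiner system `S_q(2,3,7)` containing both `Z₁ = {x : x₁ = x₂ = x₃ = x₄ = 0}`
and `Z₂ = {x : x₄ = x₅ = x₆ = x₇ = 0}`, the number of blocks meeting both `Z₁` and `Z₂`
nontrivially is exactly `(q²+q+1)²`. -/
theorem steiner_237_meet_Z1_and_Z2_count (q : ℕ) (F : Type) [Field F] [Fintype F]
    (hq : Fintype.card F = q)
    (S : Set (Submodule F (Fin 7 → F))) (hS : IsSteinerSystem F 2 3 7 S)
    (hZ1 : coordZero F ({0, 1, 2, 3} : Set (Fin 7)) ∈ S)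
    (hZ2 : coordZero F ({3, 4, 5, 6} : Set (Fin 7)) ∈ S) :
    {B ∈ S | B ⊓ coordZero F ({0, 1, 2, 3} : Set (Fin 7)) ≠ ⊥ ∧
        B ⊓ coordZero F ({3, 4, 5, 6} : Set (Fin 7)) ≠ ⊥}.ncard =
      (q ^ 2 + q + 1) ^ 2 := by
  have hdisj : Disjoint (coordZero F ({0, 1, 2, 3} : Set (Fin 7)))
      (coordZero F ({3, 4, 5, 6} : Set (Fin 7))) :=
    disjoint_coordZero (by ext i; fin_cases i <;> simp)
  rw [(hS.bijOn_inf hZ1 hZ2 hdisj).ncard_eq, Set.ncard_prod,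
    ncard_finrank_one_le _ (hS.1 _ hZ1), ncard_finrank_one_le _ (hS.1 _ hZ2),
    Nat.card_eq_fintype_card, hq]
  simp only [Finset.sum_range_succ, Finset.sum_range_zero]
  ring
end

section
/- Let S be a q-Steiner system S_q(2,3,7) containing the block Z₁ = {x ∈ 𝔽^7 : x₁ = x₂ = x₃ = x₄ = 0}, and suppose there exists a block Y ∈ S whose image under the linear projection ρ : 𝔽^7 → 𝔽^4 onto the first four coordinates equals the 2-dimensional subspace {y ∈ 𝔽^4 : y₁ = y₂ = 0}. Then there exists a linear equivalence f : 𝔽^7 ≃ 𝔽^7 such that the image system { f(B) : B ∈ S } is a q-Steiner system S_q(2,3,7) containing both Z₁ and Z₃ = {x ∈ 𝔽^7 : x₁ = x₂ = x₅ = x₆ = 0}. (In the paper's language: one may force Z₁ together with a second block having its four all-zero columns in positions 1, 2, 5 and 6.) -/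
/-- The linear projection of `F^7` onto its first four coordinates. -/
def projFirst4 (F : Type) [Field F] : (Fin 7 → F) →ₗ[F] (Fin 4 → F) :=
  LinearMap.funLeft F F (Fin.castLE (by omega))

theorem mem_coordZero {F : Type} [Field F] {n : ℕ} {s : Set (Fin n)} {x : Fin n → F} :
    x ∈ coordZero F s ↔ ∀ i ∈ s, x i = 0 := Iff.rfl

theorem finrank_coordZero (F : Type) [Field F] {n : ℕ} (s : Set (Fin n)) :
    Module.finrank F (coordZero F s) = n - s.ncard := by
  classical
  have h : coordZero F s =
      ⨅ i ∈ s, LinearMap.ker (LinearMap.proj i : (Fin n → F) →ₗ[F] F) := by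
    ext x
    simp [mem_coordZero]
  rw [h, (LinearMap.iInfKerProjEquiv F (fun _ : Fin n => F)
    (I := sᶜ) (J := s) disjoint_compl_left (by simp)).finrank_eq,
    Module.finrank_fintype_fun_eq_card, Fintype.card_compl_set, Fintype.card_fin,
    Set.ncard_eq_toFinset_card', Set.toFinset_card]

theorem IsSteinerSystem.map {F : Type} [Field F] {t k n : ℕ}
    {S : Set (Submodule F (Fin n → F))} (hS : IsSteinerSystem F t k n S)
    (f : (Fin n → F) ≃ₗ[F] (Fin n → F)) :
    IsSteinerSystem F t k n (Submodule.map f.toLinearMap '' S) := by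
  refine ⟨?_, fun T hT => ?_⟩
  · rintro _ ⟨B, hB, rfl⟩
    exact (f.finrank_map_eq B).trans (hS.1 B hB)
  · obtain ⟨B, ⟨hB, hTB⟩, huniq⟩ :=
      hS.2 (T.comap f.toLinearMap) (by
        rw [← f.finrank_map_eq, Submodule.map_comap_eq_of_surjective f.surjective, hT])
    refine ⟨B.map f.toLinearMap, ⟨⟨B, hB, rfl⟩, ?_⟩, ?_⟩
    · rw [← Submodule.map_comap_eq_of_surjective (f := f.toLinearMap) f.surjective T]
      exact Submodule.map_mono hTB
    · rintro _ ⟨⟨C, hC, rfl⟩, hTC⟩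
      congr 1
      refine huniq C ⟨hC, ?_⟩
      rw [← Submodule.comap_map_eq_of_injective (f := f.toLinearMap) f.injective C]
      exact Submodule.comap_mono hTC

/-- The general linear group acts transitively on nonzero vectors. -/
theorem exists_linearEquiv_apply_eq {K V : Type*} [Field K] [AddCommGroup V] [Module K V]
    [FiniteDimensional K V] {v w : V} (hv : v ≠ 0) (hw : w ≠ 0) :
    ∃ e : V ≃ₗ[K] V, e v = w := by
  let f := (LinearEquiv.toSpanNonzeroSingleton K V v hv).symm.trans
    (LinearEquiv.toSpanNonzeroSingleton K V w hw)
  obtain ⟨e, he⟩ := Submodule.exists_linearEquiv_restrict_eq f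
  refine ⟨e, ?_⟩
  have h1 : (LinearEquiv.toSpanNonzeroSingleton K V v hv).symm
      ⟨v, Submodule.mem_span_singleton_self v⟩ = 1 := by
    rw [LinearEquiv.symm_apply_eq]
    ext
    simp
  simpa [f, h1] using (he ⟨v, Submodule.mem_span_singleton_self v⟩).symm

theorem exists_ne_zero_mem_of_finrank_map_lt {K V W : Type*} [Field K] [AddCommGroup V]
    [Module K V] [AddCommGroup W] [Module K W] (f : V →ₗ[K] W) (Y : Submodule K V)
    (h : Module.finrank K (Y.map f) < Module.finrank K Y) :
    ∃ w ∈ Y, f w = 0 ∧ w ≠ 0 := by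
  by_contra! hc
  refine h.ne' (LinearEquiv.ofInjective (f.domRestrict Y) ?_ |>.finrank_eq.trans ?_)
  · rw [← LinearMap.ker_eq_bot, LinearMap.ker_eq_bot']
    exact fun y hy => Subtype.ext (hc y y.2 hy)
  · rw [LinearMap.range_domRestrict]

theorem map_linearEquiv_eq_of_le {K V : Type*} [Field K] [AddCommGroup V] [Module K V]
    [FiniteDimensional K V] (e : V ≃ₗ[K] V) {A B : Submodule K V}
    (h : ∀ x ∈ A, e x ∈ B) (hd : Module.finrank K A = Module.finrank K B) :
    B.map e.symm.toLinearMap = A := by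
  have h1 : A.map e.toLinearMap = B :=
    Submodule.eq_of_le_of_finrank_eq (Submodule.map_le_iff_le_comap.mpr h)
      ((e.finrank_map_eq A).trans hd)
  rw [← h1, ← Submodule.map_comp]
  simp

/-- If a `q`-Steiner system `S_q(2,3,7)` contains `Z₁ = {x : x₁ = x₂ = x₃ = x₄ = 0}`
and has a block `Y` projecting onto the first four coordinates to the `2`-dimensional
subspace `{y ∈ F⁴ : y₁ = y₂ = 0}`, then there is a linear equivalence of `F^7` that
carries `S` to a `q`-Steiner system containing both `Z₁` and
`Z₃ = {x : x₁ = x₂ = x₅ = x₆ = 0}`. -/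
theorem steiner_wlog_Z1_Z3 (F : Type) [Field F] [Fintype F]
    (S : Set (Submodule F (Fin 7 → F))) (hS : IsSteinerSystem F 2 3 7 S)
    (hZ1 : coordZero F ({0, 1, 2, 3} : Set (Fin 7)) ∈ S)
    (hY : ∃ Y ∈ S,
      Submodule.map (projFirst4 F) Y = coordZero F ({0, 1} : Set (Fin 4))) :
    ∃ f : (Fin 7 → F) ≃ₗ[F] (Fin 7 → F),
      IsSteinerSystem F 2 3 7 (Submodule.map f.toLinearMap '' S) ∧
      coordZero F ({0, 1, 2, 3} : Set (Fin 7)) ∈ Submodule.map f.toLinearMap '' S ∧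
      coordZero F ({0, 1, 4, 5} : Set (Fin 7)) ∈ Submodule.map f.toLinearMap '' S := by
  obtain ⟨Y, hYS, hYmap⟩ := hY
  have hZ3_finrank : Module.finrank F (coordZero F ({0, 1, 4, 5} : Set (Fin 7))) = 3 := by
    simp [finrank_coordZero, Set.ncard_eq_toFinset_card']
  have himage : Module.finrank F (coordZero F ({0, 1} : Set (Fin 4))) = 2 := by
    simp [finrank_coordZero, Set.ncard_eq_toFinset_card']
  have hlift : ∀ y ∈ coordZero F ({0, 1} : Set (Fin 4)), ∃ u ∈ Y, projFirst4 F u = y := by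
    intro y hy
    rwa [← hYmap] at hy
  obtain ⟨u, huY, hu⟩ := hlift ![0, 0, 1, 0] (by simp [mem_coordZero])
  obtain ⟨v, hvY, hv⟩ := hlift ![0, 0, 0, 1] (by simp [mem_coordZero])
  obtain ⟨w, hwY, hw, hw0⟩ := exists_ne_zero_mem_of_finrank_map_lt (projFirst4 F) Y (by
    rw [hYmap, himage, hS.1 Y hYS]; norm_num)
  have hcoord (x : Fin 7 → F) (y : Fin 4 → F) (h : projFirst4 F x = y) :
      x 0 = y 0 ∧ x 1 = y 1 ∧ x 2 = y 2 ∧ x 3 = y 3 := by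
    subst h
    exact ⟨rfl, rfl, rfl, rfl⟩
  obtain ⟨hu0, hu1, hu2, hu3⟩ := hcoord u _ hu
  obtain ⟨hv0, hv1, hv2, hv3⟩ := hcoord v _ hv
  obtain ⟨hw0', hw1, hw2, hw3⟩ := hcoord w _ hw
  simp at hu0 hu1 hu2 hu3 hv0 hv1 hv2 hv3 hw0' hw1 hw2 hw3
  have hw_tail : ![w 4, w 5, w 6] ≠ 0 := by
    intro h
    apply hw0
    have h4 := congrFun h 0
    have h5 := congrFun h 1
    have h6 := congrFun h 2
    ext i
    fin_cases i <;> simp_all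
  obtain ⟨L, hL⟩ := exists_linearEquiv_apply_eq (K := F) (V := Fin 3 → F) (v := ![0, 0, 1])
    (fun h => one_ne_zero (congrFun h 2)) hw_tail
  let tail : (Fin 7 → F) →ₗ[F] (Fin 3 → F) := LinearMap.funLeft F F ![4, 5, 6]
  have htail (x : Fin 7 → F) : tail x = ![x 4, x 5, x 6] := by
    ext i
    fin_cases i <;> rfl
  let Lt : (Fin 7 → F) →ₗ[F] (Fin 3 → F) := L.toLinearMap ∘ₗ tail
  let g : (Fin 7 → F) →ₗ[F] (Fin 7 → F) :=
    (LinearMap.proj (φ := fun _ : Fin 7 => F) 2).smulRight u +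
      (LinearMap.proj (φ := fun _ : Fin 7 => F) 3).smulRight v +
      LinearMap.pi (![LinearMap.proj 0, LinearMap.proj 1, 0, 0, LinearMap.proj 0 ∘ₗ Lt,
        LinearMap.proj 1 ∘ₗ Lt, LinearMap.proj 2 ∘ₗ Lt] : Fin 7 → (Fin 7 → F) →ₗ[F] F)
  have hg (x : Fin 7 → F) : g x = x 2 • u + x 3 • v +
      ![x 0, x 1, 0, 0, L (tail x) 0, L (tail x) 1, L (tail x) 2] := by
    ext i
    fin_cases i <;> rfl
  have hg_inj : Function.Injective g := by
    rw [← LinearMap.ker_eq_bot, LinearMap.ker_eq_bot']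
    intro x hx
    rw [hg] at hx
    have h0 : x 0 = 0 := by simpa [hu0, hv0] using congrFun hx 0
    have h1 : x 1 = 0 := by simpa [hu1, hv1] using congrFun hx 1
    have h2 : x 2 = 0 := by simpa [hu2, hv2] using congrFun hx 2
    have h3 : x 3 = 0 := by simpa [hu3, hv3] using congrFun hx 3
    have hLx : L (tail x) = 0 := by
      ext i
      fin_cases i
      · simpa [h2, h3] using congrFun hx 4
      · simpa [h2, h3] using congrFun hx 5
      · simpa [h2, h3] using congrFun hx 6
    have ht := L.map_eq_zero_iff.mp hLx
    rw [htail] at ht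
    have h4 : x 4 = 0 := congrFun ht 0
    have h5 : x 5 = 0 := congrFun ht 1
    have h6 : x 6 = 0 := congrFun ht 2
    ext i
    fin_cases i <;> assumption
  let e := LinearEquiv.ofInjectiveEndo g hg_inj
  have he (x : Fin 7 → F) : e x = g x := rfl
  refine ⟨e.symm, hS.map e.symm, ⟨_, hZ1, map_linearEquiv_eq_of_le e ?_ rfl⟩,
    ⟨Y, hYS, map_linearEquiv_eq_of_le e ?_ (hZ3_finrank.trans (hS.1 Y hYS).symm)⟩⟩
  · intro x hx
    simp only [mem_coordZero, Set.mem_insert_iff, Set.mem_singleton_iff, forall_eq_or_imp,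
      forall_eq] at hx ⊢
    obtain ⟨h0, h1, h2, h3⟩ := hx
    simp [he, hg, h0, h1, h2, h3]
  · intro x hx
    simp only [mem_coordZero, Set.mem_insert_iff, Set.mem_singleton_iff, forall_eq_or_imp,
      forall_eq] at hx
    obtain ⟨h0, h1, h4, h5⟩ := hx
    have ht : tail x = x 6 • ![0, 0, 1] := by
      rw [htail, h4, h5]
      simp
    have hgx : g x = x 2 • u + x 3 • v + x 6 • w := by
      rw [hg, ht, map_smul, hL, h0, h1]
      congr 1
      ext i
      fin_cases i <;> simp [hw0', hw1, hw2, hw3]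
    rw [he, hgx]
    exact Y.add_mem (Y.add_mem (Y.smul_mem _ huY) (Y.smul_mem _ hvY)) (Y.smul_mem _ hwY)
end
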